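/- arXiv:2005.06222 — 2 statements merged into one kernel-verified Lean document; each statement's English description precedes it below -/
import Mathlib

section
/- For a partition λ of n, the number of simple linear transformations in ℒ(V) (over all subspaces of the n-dimensional space V over 𝔽_q as domains) with defect dimension sequence λ equals q^{∑_{j≥2} λ_j²} · [n choose n−λ₁, λ₁−λ₂, …, λ_ℓ]_q · γ_q(n − λ₁). -/
open Submodule

section Defs
variable {K V : Type*} [Field K] [AddCommGroup V] [Module K V]

/-- The chain of subspaces `W₀ = V`, `W₁ = W`, `W_{i+1} = {v ∈ W_i : T v ∈ W_i}`. -/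
def subChain (W : Submodule K V) (T : ↥W →ₗ[K] V) : ℕ → Submodule K V
  | 0 => ⊤
  | 1 => W
  | (i+2) => subChain W T (i+1) ⊓ Submodule.map W.subtype ((subChain W T (i+1)).comap T)

theorem subChain_le (W : Submodule K V) (T : ↥W →ₗ[K] V) : ∀ k, subChain W T (k+1) ≤ W := by
  intro k
  induction k with
  | zero => simp [subChain]
  | succ k ih =>
      have h : subChain W T (k+2) ≤ subChain W T (k+1) := by
        rw [subChain]; exact inf_le_left
      exact le_trans h ih

/-- The `j`-th defect dimension `λ_{j+1} = dim W_j − dim W_{j+1}` (0-indexed). -/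
noncomputable def defect (W : Submodule K V) (T : ↥W →ₗ[K] V) (j : ℕ) : ℕ :=
  Module.finrank K (subChain W T j) - Module.finrank K (subChain W T (j+1))

/-- `U` is a `T`-invariant subspace of the domain `W`. -/
def TInv (W : Submodule K V) (T : ↥W →ₗ[K] V) (U : Submodule K V) : Prop :=
  U ≤ W ∧ ∀ v : ↥W, (v : V) ∈ U → T v ∈ U

/-- `T` is simple: its only invariant subspace is zero. -/
def SimpleMap (W : Submodule K V) (T : ↥W →ₗ[K] V) : Prop :=
  ∀ U : Submodule K V, TInv W T U → U = ⊥

/-- Similarity of linear maps defined on subspaces of `V`. -/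
def SimilarMap (W W' : Submodule K V) (T : ↥W →ₗ[K] V) (T' : ↥W' →ₗ[K] V) : Prop :=
  ∃ S : V ≃ₗ[K] V, W.map (S : V →ₗ[K] V) = W' ∧
    ∀ (v : ↥W) (hv : S (v : V) ∈ W'), S (T v) = T' ⟨S (v : V), hv⟩

/-- Gaussian binomial coefficient via the `q`-Pascal recurrence. -/
def qBinom (q : ℕ) : ℕ → ℕ → ℕ
  | _, 0 => 1
  | 0, _+1 => 0
  | n+1, k+1 => qBinom q n k + q ^ (k+1) * qBinom q n (k+1)

/-- Gaussian multinomial coefficient. -/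
def qMultinom (q : ℕ) : List ℕ → ℕ
  | [] => 1
  | a :: l => qBinom q (a + l.sum) a * qMultinom q l

/-- `γ_q(m) = ∏_{i=0}^{m−1}(q^m − q^i)`, the order of `GL_m(𝔽_q)`. -/
def gammaq (q m : ℕ) : ℕ := ∏ i ∈ Finset.range m, (q ^ m - q ^ i)

/-- `f` encodes a partition of `n`: `f i` is the `(i+1)`-st part. -/
def IsPartition (n : ℕ) (f : ℕ → ℕ) : Prop :=
  Antitone f ∧ (∀ i, n ≤ i → f i = 0) ∧ ∑ i ∈ Finset.range n, f i = n

end Defs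

section Algebra

/-- Integer version of the number of injective maps from dimension `k` to dimension `n`. -/
def injZ (q n k : ℕ) : ℤ := ∏ i ∈ Finset.range k, ((q : ℤ) ^ n - (q : ℤ) ^ i)

/-- The number of injective maps from dimension `k` to dimension `n`. -/
def injN (q n k : ℕ) : ℕ := ∏ i ∈ Finset.range k, (q ^ n - q ^ i)

theorem injZ_eq (q n k : ℕ) (hq : 1 ≤ q) (hk : k ≤ n) : (injN q n k : ℤ) = injZ q n k := by
  unfold injN injZ
  rw [Nat.cast_prod]
  refine Finset.prod_congr rfl fun i hi => ?_
  have := Finset.mem_range.1 hi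
  rw [Nat.cast_sub (Nat.pow_le_pow_right hq (by omega))]
  push_cast
  rfl

theorem injZ_succ_succ (q n k : ℕ) :
    injZ q (n+1) (k+1) = ((q:ℤ)^(n+1) - 1) * (q:ℤ)^k * injZ q n k := by
  unfold injZ
  rw [Finset.prod_range_succ']
  have : ∀ i ∈ Finset.range k, ((q:ℤ)^(n+1) - (q:ℤ)^(i+1)) = q * ((q:ℤ)^n - (q:ℤ)^i) := by
    intro i _; ring
  rw [Finset.prod_congr rfl this, Finset.prod_mul_distrib]
  simp
  ring

theorem qBinom_mul (q n k : ℕ) : (qBinom q n k : ℤ) * injZ q k k = injZ q n k := by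
  induction n generalizing k with
  | zero =>
    cases k with
    | zero => simp [qBinom, injZ]
    | succ k =>
      simp only [qBinom, injZ]
      rw [Finset.prod_range_succ' (fun i => (q:ℤ)^0 - (q:ℤ)^i)]
      simp
  | succ n ih =>
    cases k with
    | zero => simp [qBinom, injZ]
    | succ k =>
      have h1 := ih k
      have h2 := ih (k+1)
      have h3 : injZ q n (k+1) = injZ q n k * ((q:ℤ)^n - (q:ℤ)^k) := by
        unfold injZ; rw [Finset.prod_range_succ]
      rw [h3, injZ_succ_succ] at h2
      rw [injZ_succ_succ, injZ_succ_succ]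
      simp only [qBinom]
      push_cast
      rw [← h1] at h2 ⊢
      linear_combination (q:ℤ)^(k+1) * h2

theorem injZ_split (q k r : ℕ) :
    injZ q (k+r) (k+r) = injZ q (k+r) k * ((q:ℤ)^(k*r) * injZ q r r) := by
  unfold injZ
  rw [Finset.prod_range_add]
  congr 1
  have : ∀ i ∈ Finset.range r, ((q:ℤ)^(k+r) - (q:ℤ)^(k+i)) = q^k * ((q:ℤ)^r - (q:ℤ)^i) := by
    intro i _; ring
  rw [Finset.prod_congr rfl this, Finset.prod_mul_distrib]
  simp [pow_mul]

theorem injZ_pos (q n : ℕ) (hq : 2 ≤ q) : 0 < injZ q n n := by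
  unfold injZ
  refine Finset.prod_pos fun i hi => ?_
  have := pow_lt_pow_right₀ (a := (q:ℤ)) (by exact_mod_cast hq) (Finset.mem_range.1 hi)
  linarith

theorem qBinom_full (q k r : ℕ) :
    injZ q (k+r) (k+r) = qBinom q (k+r) k * injZ q k k * ((q:ℤ)^(k*r) * injZ q r r) := by
  rw [injZ_split, qBinom_mul]

theorem injZ_eq_symm (q k r : ℕ) (hq : 2 ≤ q) :
    injZ q (k+r) k = qBinom q (k+r) r * injZ q k k := by
  have h1 := injZ_split q k r
  have h2 := qBinom_full q r k
  rw [add_comm r k] at h2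
  have h3 : (q:ℤ)^(k*r) * injZ q r r ≠ 0 :=
    mul_ne_zero (pow_ne_zero _ (by positivity)) (injZ_pos q r hq).ne'
  apply mul_right_cancel₀ h3
  rw [← h1, h2, mul_comm r k]
  ring

/-- The algebraic step. -/
theorem alg_step (q a b m : ℕ) (hq : 2 ≤ q) (hab : b ≤ a) (hbm : b ≤ m) :
    q^(m*b) * injN q a b * qBinom q m (m-b) * gammaq q (m-b)
      = q^(b^2) * qBinom q a (a-b) * gammaq q m := by
  obtain ⟨r, rfl⟩ := Nat.exists_eq_add_of_le hbm
  obtain ⟨s, rfl⟩ := Nat.exists_eq_add_of_le hab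
  have hg : ∀ x, (gammaq q x : ℤ) = injZ q x x := fun x => injZ_eq q x x (by omega) le_rfl
  simp only [Nat.add_sub_cancel_left]
  zify
  rw [hg, hg, injZ_eq q _ _ (by omega) hab, injZ_eq_symm q b s hq]
  have h2 := qBinom_full q r b
  rw [add_comm r b] at h2
  rw [h2]
  ring

end Algebra

section Count
set_option linter.unusedSectionVars false
open Module

theorem card_fiber {A B : Type*} [Finite A] [Finite B] (g : A → B) (c : ℕ)
    (h : ∀ b, Nat.card {a // g a = b} = c) : Nat.card A = Nat.card B * c := by
  classical
  have := Fintype.ofFinite B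
  rw [← Nat.card_congr (Equiv.sigmaFiberEquiv g), Nat.card_sigma]
  simp [h]

variable {F V : Type*} [Field F] [Fintype F] [AddCommGroup V] [Module F V] [FiniteDimensional F V]

theorem card_li (k : ℕ) (hk : k ≤ finrank F V) :
    Nat.card {s : Fin k → V // LinearIndependent F s} = injN (Fintype.card F) (finrank F V) k := by
  have : Finite V := Module.finite_of_finite F
  have := Fintype.ofFinite V
  rw [card_linearIndependent hk, injN, Finset.prod_range]

theorem card_inj {C : Type*} [AddCommGroup C] [Module F C] [FiniteDimensional F C]
    (hk : finrank F C ≤ finrank F V) :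
    Nat.card {g : C →ₗ[F] V // Function.Injective g} =
      injN (Fintype.card F) (finrank F V) (finrank F C) := by
  rw [← card_li _ hk]
  let b := finBasis F C
  refine Nat.card_congr (((b.constr F (M' := V)).symm.toEquiv).subtypeEquiv fun g => ?_)
  have : (b.constr F (M' := V)).symm.toEquiv g = g ∘ b := by
    ext i; simp [Basis.constr]
  rw [this]
  constructor
  · intro h
    exact b.linearIndependent.map' g (LinearMap.ker_eq_bot.2 h)
  · intro h
    have e : g = Finsupp.linearCombination F (g ∘ b) ∘ₗ b.repr.toLinearMap := by
      apply b.ext; simp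
    rw [e]
    exact Function.Injective.comp (g := Finsupp.linearCombination F (g ∘ b)) h b.repr.injective

theorem card_hom {C W : Type*} [AddCommGroup C] [Module F C] [FiniteDimensional F C]
    [AddCommGroup W] [Module F W] [FiniteDimensional F W] :
    Nat.card (C →ₗ[F] W) = Fintype.card F ^ (finrank F C * finrank F W) := by
  rw [← Module.finrank_linearMap F F, Module.natCard_eq_pow_finrank (K := F), Nat.card_eq_fintype_card]

theorem card_subspaces (m : ℕ) (hm : m ≤ finrank F V) :
    Nat.card {W : Submodule F V // finrank F W = m} =
      qBinom (Fintype.card F) (finrank F V) m := by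
  have : Finite V := Module.finite_of_finite F
  have hq : 2 ≤ Fintype.card F := Fintype.one_lt_card
  have key : injN (Fintype.card F) (finrank F V) m =
      Nat.card {W : Submodule F V // finrank F W = m} * injN (Fintype.card F) m m := by
    rw [← card_li m hm]
    refine card_fiber (fun s => ⟨Submodule.span F (Set.range s.1), by
      rw [finrank_span_eq_card s.2, Fintype.card_fin]⟩) _ ?_
    rintro ⟨W, hW⟩
    subst hW
    rw [← card_li (V := W) _ le_rfl]
    refine Nat.card_congr ⟨fun s => ⟨fun i => ⟨s.1.1 i, ?_⟩, ?_⟩,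
      fun t => ⟨⟨fun i => t.1 i, ?_⟩, ?_⟩, ?_, ?_⟩
    · have h := congrArg Subtype.val s.2
      simp only at h
      have : s.1.1 i ∈ Submodule.span F (Set.range s.1.1) := Submodule.subset_span ⟨i, rfl⟩
      exact h.le this
    · apply LinearIndependent.of_comp W.subtype
      exact s.1.2
    · exact t.2.map' W.subtype W.ker_subtype
    · ext1
      simp only
      apply Submodule.eq_of_le_of_finrank_eq
      · rw [Submodule.span_le]
        rintro _ ⟨i, rfl⟩
        exact (t.1 i).2
      · have := t.2.map' W.subtype W.ker_subtype
        exact (finrank_span_eq_card this).trans (Fintype.card_fin _)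
    · intro s; rfl
    · intro t; rfl
  have h1 := qBinom_mul (Fintype.card F) (finrank F V) m
  have h0 := injZ_pos (Fintype.card F) m hq
  zify at key
  rw [injZ_eq _ _ _ (by omega) hm, injZ_eq _ _ _ (by omega) le_rfl, ← h1] at key
  have := mul_right_cancel₀ h0.ne' key
  exact_mod_cast this.symm

/-- The derived map on `T⁻¹(W)`. -/
def derived (W : Submodule F V) (T : W →ₗ[F] V) : Σ W' : Submodule F W, (W' →ₗ[F] W) :=
  ⟨W.comap T, T.restrict (fun _ h => h)⟩

theorem derived_eq_iff (W : Submodule F V) (T : W →ₗ[F] V) (W' : Submodule F W)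
    (T' : W' →ₗ[F] W) : derived W T = ⟨W', T'⟩ ↔
      (∀ w, T w ∈ W ↔ w ∈ W') ∧ ∀ w : W', T w = T' w := by
  constructor
  · intro h
    unfold derived at h
    cases h
    exact ⟨fun w => Iff.rfl, fun w => rfl⟩
  · rintro ⟨h1, h2⟩
    have : W' = W.comap T := by ext w; exact (h1 w).symm
    subst this
    unfold derived
    congr 1
    ext w
    exact h2 w

theorem subChain_derived (W : Submodule F V) (T : W →ₗ[F] V) (j : ℕ) :
    subChain (derived W T).1 (derived W T).2 j = (subChain W T (j+1)).comap W.subtype := by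
  induction j with
  | zero => simp [subChain]
  | succ j ih =>
    cases j with
    | zero =>
      ext w
      simp [subChain, derived]
    | succ j =>
      rw [subChain, ih, subChain]
      ext w
      simp only [Submodule.mem_inf, Submodule.mem_comap, Submodule.mem_map, derived]
      have hle := subChain_le W T (j+1)
      refine and_congr_right fun hw => ?_
      constructor
      · rintro ⟨y, hy, rfl⟩
        exact ⟨y, hy, rfl⟩
      · rintro ⟨y, hy, hyw⟩
        have : y = w := Subtype.ext hyw
        subst this
        exact ⟨⟨y, hle hy⟩, hy, rfl⟩

theorem defect_derived (W : Submodule F V) (T : W →ₗ[F] V) (j : ℕ) :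
    defect (derived W T).1 (derived W T).2 j = defect W T (j+1) := by
  unfold defect
  rw [subChain_derived, subChain_derived]
  rw [(Submodule.comapSubtypeEquivOfLe (subChain_le W T j)).finrank_eq,
    (Submodule.comapSubtypeEquivOfLe (subChain_le W T (j+1))).finrank_eq]

theorem card_ext (W : Submodule F V) (p' : Σ W' : Submodule F W, (W' →ₗ[F] W)) (a b : ℕ)
    (ha : finrank F V = finrank F W + a) (hb : finrank F W = finrank F p'.1 + b) (hab : b ≤ a) :
    Nat.card {T : W →ₗ[F] V // derived W T = p'} =
      Fintype.card F ^ (finrank F W * b) * injN (Fintype.card F) a b := by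
  obtain ⟨W', T'⟩ := p'
  obtain ⟨C, hC⟩ := Submodule.exists_isCompl W'
  obtain ⟨D, hD⟩ := Submodule.exists_isCompl W
  have hCb : finrank F C = b := by
    have := Submodule.finrank_add_eq_of_isCompl hC
    simp only at hb
    omega
  have hDa : finrank F D = a := by
    have := Submodule.finrank_add_eq_of_isCompl hD
    omega
  let e := Submodule.prodEquivOfIsCompl W D hD
  have h1 : {T : W →ₗ[F] V // derived W T = ⟨W', T'⟩} ≃
      (C →ₗ[F] W) × {g : C →ₗ[F] D // Function.Injective g} := by
    refine ⟨fun T => ⟨LinearMap.fst F W D ∘ₗ e.symm.toLinearMap ∘ₗ T.1 ∘ₗ C.subtype,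
        LinearMap.snd F W D ∘ₗ e.symm.toLinearMap ∘ₗ T.1 ∘ₗ C.subtype, ?_⟩,
      fun g => ⟨LinearMap.ofIsCompl hC (W.subtype ∘ₗ T') (e.toLinearMap ∘ₗ g.1.prod g.2.1), ?_⟩,
      ?_, ?_⟩
    · obtain ⟨T, hT⟩ := T
      rw [derived_eq_iff] at hT
      rw [← LinearMap.ker_eq_bot, LinearMap.ker_eq_bot']
      intro c hc
      have h2 : T c ∈ W := (Submodule.prodEquivOfIsCompl_symm_apply_snd_eq_zero _ _ hD).1 hc
      rw [hT.1] at h2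
      have := Submodule.disjoint_def.1 hC.disjoint _ h2 c.2
      exact Subtype.ext this
    · obtain ⟨g1, g2, hg⟩ := g
      rw [derived_eq_iff]
      constructor
      · intro w
        obtain ⟨u, c, rfl, -⟩ := Submodule.existsUnique_add_of_isCompl hC w
        rw [map_add, LinearMap.ofIsCompl_apply_left, LinearMap.ofIsCompl_apply_right]
        rw [Submodule.add_mem_iff_right _ (by simp), Submodule.add_mem_iff_right _ u.2]
        have h3 : (e.toLinearMap ∘ₗ g1.prod g2) c ∈ W ↔ g2 c = 0 := by
          rw [← Submodule.prodEquivOfIsCompl_symm_apply_snd_eq_zero _ _ hD]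
          change (e.symm (e (g1 c, g2 c))).2 = 0 ↔ _
          rw [e.symm_apply_apply]
        rw [h3, map_eq_zero_iff g2 hg]
        constructor
        · rintro rfl; simp
        · intro h
          exact Subtype.ext (Submodule.disjoint_def.1 hC.disjoint _ h c.2)
      · intro w
        rw [LinearMap.ofIsCompl_apply_left]
        rfl
    · rintro ⟨T, hT⟩
      rw [derived_eq_iff] at hT
      ext1
      simp only
      apply LinearMap.ofIsCompl_eq
      · intro u; exact (hT.2 u).symm
      · intro c
        change e (e.symm (T c)) = T c
        rw [e.apply_symm_apply]
    · rintro ⟨g1, g2, hg⟩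
      refine Prod.ext ?_ (Subtype.ext ?_)
      · ext1 c
        simp only [LinearMap.comp_apply, Submodule.subtype_apply, LinearMap.ofIsCompl_apply_right]
        simp
      · ext1 c
        simp only [LinearMap.comp_apply, Submodule.subtype_apply, LinearMap.ofIsCompl_apply_right]
        simp
  rw [Nat.card_congr h1, Nat.card_prod, card_hom, card_inj (by omega), hCb, hDa, mul_comm b]

end Count
section Main
open Module

theorem le_sum_of_zero (f : ℕ → ℕ) (N : ℕ) (h0 : ∀ i, N ≤ i → f i = 0) :
    f 0 ≤ ∑ i ∈ Finset.range N, f i := by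
  cases N with
  | zero => simp [h0 0 le_rfl]
  | succ N => exact Finset.single_le_sum (fun _ _ => Nat.zero_le _) (Finset.mem_range.2 (by omega))

theorem sum_ofFn_diff (f : ℕ → ℕ) (N : ℕ) (hf : Antitone f) (h0 : ∀ i, N ≤ i → f i = 0) :
    (List.ofFn (fun i : Fin N => f i.val - f (i.val + 1))).sum = f 0 := by
  rw [List.sum_ofFn, Finset.sum_fin_eq_sum_range, Finset.sum_congr rfl (g := fun i => f i - f (i+1))]
  · have : ∀ M, ∑ i ∈ Finset.range M, (f i - f (i+1)) + f M = f 0 := by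
      intro M
      induction M with
      | zero => simp
      | succ M ih =>
        rw [Finset.sum_range_succ]
        have := hf (Nat.le_succ M)
        simp only [Nat.succ_eq_add_one] at this
        omega
    have := this N
    rw [h0 N le_rfl] at this
    exact this
  · intro i hi
    simp [Finset.mem_range.1 hi]

theorem d0 {F V : Type*} [Field F] [AddCommGroup V] [Module F V] (W : Submodule F V)
    (T : W →ₗ[F] V) : defect W T 0 = finrank F V - finrank F W := by
  have h0 : subChain W T 0 = ⊤ := by rw [subChain]
  have h1 : subChain W T (0+1) = W := by rw [subChain]
  rw [defect, h0, h1, finrank_top]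

theorem count_main {F : Type*} [Field F] [Fintype F] (N : ℕ) : ∀ (V : Type*) [AddCommGroup V]
    [Module F V] [FiniteDimensional F V] (f : ℕ → ℕ), Antitone f → (∀ i, N ≤ i → f i = 0) →
    ∑ i ∈ Finset.range N, f i = finrank F V →
    Nat.card {p : Σ W : Submodule F V, (↥W →ₗ[F] V) // ∀ j, defect p.1 p.2 j = f j} =
      Fintype.card F ^ (∑ i ∈ Finset.range N, (f (i + 1)) ^ 2) *
        qMultinom (Fintype.card F)
          ((finrank F V - f 0) :: List.ofFn (fun i : Fin N => f i.val - f (i.val + 1))) *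
        gammaq (Fintype.card F) (finrank F V - f 0) := by
  induction N with
  | zero =>
    intro V _ _ _ f hf h0 hs
    simp only [Finset.range_zero, Finset.sum_empty] at hs
    rw [← hs]
    have hV : Subsingleton V := Module.finrank_zero_iff.1 hs.symm
    simp only [Finset.range_zero, Finset.sum_empty, pow_zero, qMultinom, List.ofFn_zero, gammaq,
      Nat.zero_sub, List.sum_nil, qBinom, Finset.prod_empty, mul_one]
    rw [Nat.card_eq_one_iff_unique]
    refine ⟨⟨?_⟩, ⟨⟨⟨⊥, 0⟩, ?_⟩⟩⟩
    · rintro ⟨⟨W, T⟩, _⟩ ⟨⟨W', T'⟩, _⟩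
      have : W = W' := Subsingleton.elim _ _
      subst this
      have : T = T' := by ext x; exact Subsingleton.elim _ _
      subst this
      rfl
    · intro j
      rw [h0 j (Nat.zero_le _), defect]
      simp [Module.finrank_zero_of_subsingleton]
  | succ N ih =>
    intro V _ _ _ f hf h0 hs
    have : Finite V := Module.finite_of_finite F
    have : ∀ W : Submodule F V, Finite (W →ₗ[F] V) := fun W => DFunLike.finite _
    have : ∀ W : Submodule F V, ∀ W' : Submodule F W, Finite (W' →ₗ[F] W) :=
      fun W W' => DFunLike.finite _
    have hf0 : f 0 ≤ finrank F V := hs ▸ le_sum_of_zero f _ h0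
    set g : ℕ → ℕ := fun i => f (i+1) with hg
    have hga : Antitone g := fun a b h => hf (by omega)
    have hg0 : ∀ i, N ≤ i → g i = 0 := fun i hi => h0 _ (by omega)
    have hgs : ∑ i ∈ Finset.range N, g i = finrank F V - f 0 := by
      rw [Finset.sum_range_succ'] at hs
      exact Nat.eq_sub_of_add_eq hs
    obtain ⟨m, hm⟩ : ∃ m, m = finrank F V - f 0 := ⟨_, rfl⟩
    rw [← hm] at hgs ⊢
    have hbm : g 0 ≤ m := hgs ▸ le_sum_of_zero g _ hg0
    have hab : g 0 ≤ f 0 := hf (by omega)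
    have hq : 2 ≤ Fintype.card F := Fintype.one_lt_card
    -- count maps with fixed domain
    have hdom : ∀ W : Submodule F V, finrank F W = m →
        Nat.card {T : W →ₗ[F] V // ∀ j, defect W T j = f j} =
        Nat.card {p : Σ W' : Submodule F W, (↥W' →ₗ[F] W) // ∀ j, defect p.1 p.2 j = g j} *
          (Fintype.card F ^ (m * g 0) * injN (Fintype.card F) (f 0) (g 0)) := by
      intro W hW
      refine card_fiber (fun T => ⟨derived W T.1, fun j => by
        rw [defect_derived]; exact T.2 (j+1)⟩) _ ?_
      rintro ⟨p', hp'⟩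
      have hp0 := hp' 0
      rw [d0, hW] at hp0
      have hle := Submodule.finrank_le p'.1
      rw [← hW, ← card_ext W p' (f 0) (g 0) (by omega) (by omega) hab]
      refine Nat.card_congr ⟨fun T => ⟨T.1.1, congrArg Subtype.val T.2⟩,
        fun T => ⟨⟨T.1, ?_⟩, Subtype.ext T.2⟩, fun _ => rfl, fun _ => rfl⟩
      intro j
      cases j with
      | zero => rw [d0]; omega
      | succ j =>
        rw [← defect_derived, T.2]
        exact hp' j
    have htot : Nat.card {p : Σ W : Submodule F V, (↥W →ₗ[F] V) // ∀ j, defect p.1 p.2 j = f j} =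
        Nat.card {W : Submodule F V // finrank F W = m} *
        (Fintype.card F ^ (∑ i ∈ Finset.range N, (g (i + 1)) ^ 2) *
        qMultinom (Fintype.card F)
          ((m - g 0) :: List.ofFn (fun i : Fin N => g i.val - g (i.val + 1))) *
        gammaq (Fintype.card F) (m - g 0) *
          (Fintype.card F ^ (m * g 0) * injN (Fintype.card F) (f 0) (g 0))) := by
      refine card_fiber (fun p => ⟨p.1.1, by
        have h := p.2 0
        rw [d0] at h
        have hle := Submodule.finrank_le p.1.1
        omega⟩) _ ?_
      rintro ⟨W, hW⟩
      have hi := ih W g hga hg0 (by rw [hgs, hW])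
      rw [hW] at hi
      rw [← hi, ← hdom W hW]
      refine Nat.card_congr (Equiv.symm (Equiv.ofBijective
        (fun T => ⟨⟨⟨W, T.1⟩, T.2⟩, rfl⟩) ⟨?_, ?_⟩))
      · intro T T' h
        simp only [Subtype.mk.injEq, Sigma.mk.injEq, heq_eq_eq, true_and] at h
        exact Subtype.ext h
      · rintro ⟨⟨⟨W', T⟩, hT⟩, h⟩
        have h' : W' = W := congrArg Subtype.val h
        subst h'
        exact ⟨⟨T, hT⟩, rfl⟩
    rw [htot, card_subspaces m (by omega)]
    have hsum := sum_ofFn_diff f (N+1) hf h0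
    have hsum' := sum_ofFn_diff g N hga hg0
    have hl : List.ofFn (fun i : Fin (N+1) => f i.val - f (i.val + 1)) =
        (f 0 - g 0) :: List.ofFn (fun i : Fin N => g i.val - g (i.val + 1)) := by
      rw [List.ofFn_succ]; rfl
    have hsq : ∑ i ∈ Finset.range (N+1), (f (i + 1)) ^ 2 =
        ∑ i ∈ Finset.range N, (g (i + 1)) ^ 2 + g 0 ^ 2 := Finset.sum_range_succ' _ _
    rw [hsq]
    simp only [qMultinom, hsum]
    rw [hl]
    simp only [qMultinom, hsum']
    have h1 : m + f 0 = finrank F V := by omega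
    have h2 : m - g 0 + g 0 = m := by omega
    have h3 : f 0 - g 0 + g 0 = f 0 := by omega
    rw [h1, h2, h3, pow_add]
    have key := alg_step (Fintype.card F) (f 0) (g 0) m hq hab hbm
    generalize qMultinom _ _ = X
    calc _ = qBinom (Fintype.card F) (finrank F V) m *
          Fintype.card F ^ (∑ i ∈ Finset.range N, (g (i + 1)) ^ 2) * X *
          (Fintype.card F ^ (m * g 0) * injN (Fintype.card F) (f 0) (g 0) *
            qBinom (Fintype.card F) m (m - g 0) * gammaq (Fintype.card F) (m - g 0)) := by ring
      _ = _ := by rw [key]; ring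

theorem simple_of_defect {F V : Type*} [Field F] [AddCommGroup V]
    [Module F V] [FiniteDimensional F V] (n : ℕ) (hn : Module.finrank F V = n)
    (f : ℕ → ℕ) (hf : ∑ i ∈ Finset.range n, f i = n) (W : Submodule F V) (T : W →ₗ[F] V)
    (h : ∀ j, defect W T j = f j) : SimpleMap W T := by
  intro U hU
  have hle : ∀ j, U ≤ subChain W T j := by
    intro j
    induction j with
    | zero => simp [subChain]
    | succ j ih =>
      cases j with
      | zero => simpa [subChain] using hU.1
      | succ j =>
        rw [subChain]
        refine le_inf ih fun u hu => ?_
        exact ⟨⟨u, hU.1 hu⟩, ih (hU.2 ⟨u, hU.1 hu⟩ hu), rfl⟩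
  have hanti : ∀ j, subChain W T (j+1) ≤ subChain W T j := by
    intro j
    cases j with
    | zero => simp [subChain]
    | succ j => rw [subChain]; exact inf_le_left
  have hsum : ∀ j, finrank F (subChain W T j) + ∑ i ∈ Finset.range j, f i = n := by
    intro j
    induction j with
    | zero =>
      have h0 : subChain W T 0 = ⊤ := by rw [subChain]
      rw [h0, finrank_top, hn]; simp
    | succ j ih =>
      rw [Finset.sum_range_succ, ← h j, defect]
      have := Submodule.finrank_mono (hanti j)
      omega
  have h0 := hsum n
  rw [hf] at h0
  have h1 : subChain W T n = ⊥ := Submodule.finrank_eq_zero.1 (by omega)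
  exact le_bot_iff.1 (h1 ▸ hle n)

end Main

/-- the number of simple linear transformations in `ℒ(V)` (over all subspaces
as domains) with defect dimension sequence `λ ⊢ n` equals
`q^{∑_{j≥2} λ_j²} · [n choose n−λ₁, λ₁−λ₂, …, λ_ℓ]_q · γ_q(n−λ₁)`. -/
theorem card_simple_maps_all_domains {F V : Type*} [Field F] [Fintype F] [AddCommGroup V]
    [Module F V] [FiniteDimensional F V] (q n : ℕ)
    (hq : Fintype.card F = q) (hn : Module.finrank F V = n)
    (f : ℕ → ℕ) (hf : IsPartition n f) :
    Nat.card {p : Σ W : Submodule F V, (↥W →ₗ[F] V) //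
        SimpleMap p.1 p.2 ∧ ∀ j, defect p.1 p.2 j = f j} =
      q ^ (∑ i ∈ Finset.range n, (f (i + 1)) ^ 2) *
        qMultinom q ((n - f 0) :: List.ofFn (fun i : Fin n => f i.val - f (i.val + 1))) *
        gammaq q (n - f 0) := by
  subst hq
  subst hn
  rw [← count_main (F := F) _ V f hf.1 hf.2.1 hf.2.2]
  refine Nat.card_congr (Equiv.subtypeEquivRight fun p => ?_)
  exact ⟨fun h => h.2, fun h => ⟨simple_of_defect _ rfl f hf.2.2 p.1 p.2 h, h⟩⟩
end

section
/- Let W be a fixed k-dimensional subspace of an n-dimensional vector space V over 𝔽_q, and fix 0 ≤ d ≤ k. Summing over all partitions λ of n − d with largest part n − k, one has ∑_λ σ(λ) = ∏_{j=1}^{k−d} (q^{n−d} − q^j), where σ(λ) = q^{∑_{i≥2} λ_i²} γ_q(k − d) ∏_{i≥1} [λ_i choose λ_{i+1}]_q (and σ(∅) = 1 when d = n = k). -/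
open Submodule

theorem qb_zero (q n : ℕ) : qBinom q n 0 = 1 := by cases n <;> rfl

theorem qb_succ (q n k : ℕ) :
    qBinom q (n+1) (k+1) = qBinom q n k + q ^ (k+1) * qBinom q n (k+1) := rfl

theorem qb_lt (q : ℕ) : ∀ n k, n < k → qBinom q n k = 0 := by
  intro n
  induction n with
  | zero => intro k hk; cases k with
    | zero => omega
    | succ k => rfl
  | succ n ih => intro k hk; cases k with
    | zero => omega
    | succ k => rw [qb_succ, ih k (by omega), ih (k+1) (by omega)]; simp

/-- q-Vandermonde. -/
theorem qb_vander (q : ℕ) : ∀ r a t, ∑ c ∈ Finset.range (r+1),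
    q ^ (c * (c + t)) * qBinom q a (c + t) * qBinom q r c = qBinom q (r + a) (r + t) := by
  intro r
  induction r with
  | zero => intro a t; simp [qb_zero]
  | succ r ih =>
    intro a t
    have e1 : r + 1 + a = r + (a + 1) := by ring
    have e2 : r + 1 + t = r + (t + 1) := by ring
    rw [e1, e2, ← ih (a+1) (t+1), Finset.sum_range_succ']
    have h1 : ∑ c ∈ Finset.range (r+1), q ^ (c * (c + t + 1)) * qBinom q a (c + t) * qBinom q r c
        = ∑ c ∈ Finset.range (r+1), q ^ ((c+1) * (c + 1 + t + 1)) * qBinom q a (c + 1 + t)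
            * qBinom q r (c+1) + qBinom q a t := by
      have := Finset.sum_range_succ
        (fun c => q ^ (c * (c + t + 1)) * qBinom q a (c + t) * qBinom q r c) (r+1)
      rw [Finset.sum_range_succ', qb_lt q r (r+1) (by omega)] at this
      simp [qb_zero] at this
      exact this.symm
    have h2 : ∀ c, q ^ (c * (c + (t + 1))) * qBinom q (a+1) (c + (t+1)) * qBinom q r c
        = q ^ (c * (c + t + 1)) * qBinom q a (c + t) * qBinom q r c
        + q ^ ((c + 1) * (c + 1 + t)) * qBinom q a (c + 1 + t) * qBinom q r c := by
      intro c
      rw [← add_assoc c t 1, qb_succ, show c + 1 + t = c + t + 1 by ring]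
      ring
    simp only [h2, Finset.sum_add_distrib, h1]
    simp only [qb_succ, qb_zero]
    simp only [zero_add, zero_mul, pow_zero, one_mul, mul_one]
    rw [add_right_comm, add_left_inj, ← Finset.sum_add_distrib]
    apply Finset.sum_congr rfl
    intro c _
    ring

theorem qb_symm (q r a : ℕ) : qBinom q (r + a) r = qBinom q (r + a) a := by
  have h1 := qb_vander q r a 0
  have h2 := qb_vander q a r 0
  simp only [add_zero] at h1 h2
  rw [← h1, add_comm r a, ← h2]
  rw [Finset.sum_subset (Finset.range_mono (show r + 1 ≤ r + a + 1 by omega)),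
    Finset.sum_subset (Finset.range_mono (show a + 1 ≤ r + a + 1 by omega))]
  · apply Finset.sum_congr rfl
    intro c _
    ring
  · intro c _ hc
    rw [qb_lt q a c (by simpa using hc)]; simp
  · intro c _ hc
    rw [qb_lt q r c (by simpa using hc)]; simp

theorem qb_prod (q : ℕ) : ∀ M m : ℕ,
    (∏ i ∈ Finset.range m, ((q:ℤ) ^ m - q ^ i)) * qBinom q M m
      = ∏ i ∈ Finset.range m, ((q:ℤ) ^ M - q ^ i) := by
  have key : ∀ M m : ℕ, ∏ i ∈ Finset.range (m+1), ((q:ℤ) ^ (M+1) - q ^ i)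
      = (q ^ (M+1) - 1) * q ^ m * ∏ i ∈ Finset.range m, ((q:ℤ) ^ M - q ^ i) := by
    intro M m
    rw [Finset.prod_range_succ']
    have : ∏ i ∈ Finset.range m, ((q:ℤ) ^ (M+1) - q ^ (i+1))
        = q ^ m * ∏ i ∈ Finset.range m, ((q:ℤ) ^ M - q ^ i) := by
      conv_lhs => enter [2, i]; rw [show (q:ℤ) ^ (M+1) - q ^ (i+1) = q * (q ^ M - q ^ i) by ring]
      rw [Finset.prod_mul_distrib]; simp
    rw [this]; ring
  intro M
  induction M with
  | zero => intro m; cases m with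
    | zero => simp [qb_zero]
    | succ m =>
      rw [qb_lt q 0 (m+1) (by omega), Finset.prod_range_succ' (fun i => (q:ℤ) ^ 0 - q ^ i)]
      simp
  | succ M ih => intro m; cases m with
    | zero => simp [qb_zero]
    | succ m =>
      have i1 := ih m
      have i2 := ih (m+1)
      rw [Finset.prod_range_succ (fun i => (q:ℤ) ^ M - q ^ i)] at i2
      rw [qb_succ, key M m]
      push_cast
      rw [mul_add, mul_left_comm, i2, key m m, mul_assoc, i1]
      ring

theorem gamma_prod (q M m : ℕ) (hm : m ≤ M) :
    gammaq q m * (q ^ m * qBinom q M m) = ∏ j ∈ Finset.Icc 1 m, (q ^ (M+1) - q ^ j) := by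
  rcases Nat.eq_zero_or_pos q with rfl | hq
  · rcases Nat.eq_zero_or_pos m with rfl | hm'
    · simp [gammaq, qb_zero]
    · rw [zero_pow (by omega), Finset.prod_eq_zero (i := 1)]
      · simp
      · simp; omega
      · simp
  · have hI : ∏ j ∈ Finset.Icc 1 m, (q ^ (M+1) - q ^ j)
        = ∏ i ∈ Finset.range m, (q ^ (M+1) - q ^ (i+1)) := by
      rw [Finset.range_eq_Ico, Finset.prod_Ico_add' (fun i => q ^ (M+1) - q ^ i)]
      rfl
    rw [hI]
    have h := qb_prod q M m
    zify
    rw [gammaq]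
    push_cast
    have c1 : ∀ i ∈ Finset.range m, ((q ^ m - q ^ i : ℕ) : ℤ) = (q:ℤ) ^ m - q ^ i := by
      intro i hi
      rw [Nat.cast_sub (Nat.pow_le_pow_right hq (by simp at hi; omega))]; simp
    have c2 : ∀ i ∈ Finset.range m, ((q ^ (M+1) - q ^ (i+1) : ℕ) : ℤ) = q * ((q:ℤ) ^ M - q ^ i) := by
      intro i hi
      rw [Nat.cast_sub (Nat.pow_le_pow_right hq (by simp at hi; omega))]; push_cast; ring
    rw [Finset.prod_congr rfl c1, Finset.prod_congr rfl c2, Finset.prod_mul_distrib, ← h]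
    simp
    ring

/-- Prepend a part. -/
def consF (a : ℕ) (g : ℕ → ℕ) : ℕ → ℕ
  | 0 => a
  | i+1 => g i

/-- Partitions of `N` with largest part `a`. -/
def PS (N a : ℕ) : Set (ℕ → ℕ) := {f | IsPartition N f ∧ f 0 = a}

/-- The weight without the factor gamma. -/
def wt (q N : ℕ) (f : ℕ → ℕ) : ℕ :=
  q ^ (∑ i ∈ Finset.range N, (f (i + 1)) ^ 2) *
    ∏ i ∈ Finset.range N, qBinom q (f i) (f (i + 1))

theorem consF_inj (a : ℕ) : Function.Injective (consF a) := by
  intro f g h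
  funext i
  exact congrFun h (i+1)

theorem sum_trunc (g : ℕ → ℕ) (m M : ℕ) (hM : m ≤ M) (hg : ∀ i, m ≤ i → g i = 0) :
    ∑ i ∈ Finset.range M, g i = ∑ i ∈ Finset.range m, g i := by
  symm
  apply Finset.sum_subset (Finset.range_mono hM)
  intro i _ hi
  exact hg i (by simpa using hi)

theorem prod_trunc (g : ℕ → ℕ) (m M : ℕ) (hM : m ≤ M) (hg : ∀ i, m ≤ i → g i = 1) :
    ∏ i ∈ Finset.range M, g i = ∏ i ∈ Finset.range m, g i := by
  symm
  apply Finset.prod_subset (Finset.range_mono hM)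
  intro i _ hi
  exact hg i (by simpa using hi)

theorem PS_rec (m a : ℕ) (ha : 1 ≤ a) :
    PS (m + a) a = ⋃ b ∈ (Finset.range (a+1) : Set ℕ), consF a '' PS m b := by
  ext f
  simp only [PS, IsPartition, Set.mem_iUnion, Set.mem_image, Set.mem_ofPred_eq, Finset.coe_range,
    Set.mem_Iio, exists_prop]
  obtain ⟨a, rfl⟩ : ∃ c, a = c + 1 := ⟨a - 1, by omega⟩
  constructor
  · rintro ⟨⟨hanti, hz, hs⟩, h0⟩
    have hganti : Antitone (fun i => f (i+1)) := fun i j hij => hanti (by omega)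
    have hs' : ∑ i ∈ Finset.range (m + a), f (i+1) = m := by
      rw [← add_assoc, Finset.sum_range_succ'] at hs
      omega
    have hgz : ∀ i, m ≤ i → f (i+1) = 0 := by
      intro i hi
      by_contra hne
      have hiN : i < m + a := by
        by_contra hc
        exact hne (hz _ (by omega))
      have h1 : ∑ j ∈ Finset.range (i+1), 1 ≤ ∑ j ∈ Finset.range (i+1), f (j+1) := by
        apply Finset.sum_le_sum
        intro j hj
        have : f (i+1) ≤ f (j+1) := hanti (by simp at hj; omega)
        omega
      have h2 : ∑ j ∈ Finset.range (i+1), f (j+1) ≤ ∑ j ∈ Finset.range (m+a), f (j+1) :=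
        Finset.sum_le_sum_of_subset (Finset.range_mono (by omega))
      simp at h1
      omega
    refine ⟨f 1, ?_, fun i => f (i+1), ⟨⟨hganti, hgz, ?_⟩, rfl⟩, ?_⟩
    · have := hanti (show 0 ≤ 1 by omega)
      omega
    · rw [← sum_trunc (fun i => f (i+1)) m (m+a) (by omega) hgz]
      exact hs'
    · funext i
      cases i with
      | zero => exact h0.symm
      | succ i => rfl
  · rintro ⟨b, hb, g, ⟨⟨hanti, hz, hs⟩, h0⟩, rfl⟩
    refine ⟨⟨?_, ?_, ?_⟩, rfl⟩
    · apply antitone_nat_of_succ_le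
      intro i
      cases i with
      | zero => simp only [consF]; omega
      | succ i => exact hanti (by omega)
    · intro i hi
      cases i with
      | zero => omega
      | succ i => exact hz i (by omega)
    · rw [← add_assoc, Finset.sum_range_succ']
      simp only [consF]
      rw [sum_trunc g m (m+a) (by omega) hz, hs]
      ring

theorem PS_empty (m : ℕ) (hm : 1 ≤ m) : PS m 0 = ∅ := by
  ext f
  simp only [PS, IsPartition, Set.mem_ofPred_eq, Set.mem_empty_iff_false, iff_false]
  rintro ⟨⟨hanti, hz, hs⟩, h0⟩
  rw [Finset.sum_eq_zero] at hs
  · omega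
  · intro i _
    have := hanti (Nat.zero_le i)
    omega

theorem PS_empty' (m b : ℕ) (hm : m < b) : PS m b = ∅ := by
  ext f
  simp only [PS, IsPartition, Set.mem_ofPred_eq, Set.mem_empty_iff_false, iff_false]
  rintro ⟨⟨hanti, hz, hs⟩, h0⟩
  rcases Nat.eq_zero_or_pos m with rfl | h
  · have := hz 0 le_rfl
    omega
  · have := Finset.single_le_sum (f := f) (fun i _ => Nat.zero_le _)
      (Finset.mem_range.2 h)
    omega

theorem PS_zero : PS 0 0 = {fun _ => 0} := by
  ext f
  simp only [PS, IsPartition, Set.mem_ofPred_eq, Set.mem_singleton_iff]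
  constructor
  · rintro ⟨⟨hanti, hz, hs⟩, h0⟩
    funext i
    exact hz i (by omega)
  · rintro rfl
    exact ⟨⟨fun _ _ _ => le_rfl, fun _ _ => rfl, rfl⟩, rfl⟩

theorem PS_fin : ∀ m a, (PS m a).Finite := by
  intro m
  induction m using Nat.strong_induction_on with
  | _ m ih =>
    intro a
    rcases lt_or_ge m a with h | h
    · rw [PS_empty' m a h]; exact Set.finite_empty
    rcases Nat.eq_zero_or_pos a with rfl | ha
    · rcases Nat.eq_zero_or_pos m with rfl | hm
      · rw [PS_zero]; exact Set.finite_singleton _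
      · rw [PS_empty m hm]; exact Set.finite_empty
    obtain ⟨m, rfl⟩ : ∃ c, m = c + a := ⟨m - a, by omega⟩
    rw [PS_rec m a ha]
    apply Set.Finite.biUnion (Finset.finite_toSet _)
    intro b _
    exact (ih m (by omega) b).image _

theorem wt_cons (q m a b : ℕ) (ha : 1 ≤ a) (g : ℕ → ℕ) (hg : g ∈ PS m b) :
    wt q (m + a) (consF a g) = q ^ (b ^ 2) * qBinom q a b * wt q m g := by
  obtain ⟨⟨hanti, hz, hs⟩, h0⟩ := hg
  obtain ⟨a, rfl⟩ : ∃ c, a = c + 1 := ⟨a - 1, by omega⟩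
  unfold wt
  rw [← add_assoc, Finset.sum_range_succ', Finset.prod_range_succ']
  simp only [consF]
  rw [sum_trunc (fun i => g (i+1) ^ 2) m (m+a) (by omega)
      (fun i hi => by simp [hz (i+1) (by omega)]),
    prod_trunc (fun i => qBinom q (g i) (g (i+1))) m (m+a) (by omega)
      (fun i hi => by simp [hz (i+1) (by omega), qb_zero]), h0]
  ring

/-- The sum of weights. -/
noncomputable def SS (q m a : ℕ) : ℕ := ∑ᶠ f ∈ PS m a, wt q m f

theorem SS_rec (q m a : ℕ) (ha : 1 ≤ a) :
    SS q (m + a) a = ∑ b ∈ Finset.range (a+1), q ^ (b ^ 2) * qBinom q a b * SS q m b := by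
  unfold SS
  rw [PS_rec m a ha, finsum_mem_biUnion _ (Finset.finite_toSet _)
    (fun b _ => (PS_fin m b).image _), finsum_mem_coe_finset]
  · apply Finset.sum_congr rfl
    intro b _
    rw [finsum_mem_image ((consF_inj a).injOn), mul_finsum_mem]
    apply finsum_mem_congr rfl
    intro g hg
    exact wt_cons q m a b ha g hg
  · intro b _ c _ hbc
    refine Set.disjoint_left.2 ?_
    rintro _ ⟨g, hg, rfl⟩ ⟨g', hg', he⟩
    have := consF_inj a he
    subst this
    exact hbc (hg.2.symm.trans hg'.2)

theorem SS_zero (q : ℕ) : SS q 0 0 = 1 := by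
  unfold SS
  rw [PS_zero, finsum_mem_singleton]
  simp [wt]

theorem SS_eq (q : ℕ) : ∀ m a, SS q (m + (a + 1)) (a + 1) = q ^ m * qBinom q (m + a) m := by
  intro m
  induction m using Nat.strong_induction_on with
  | _ m ih =>
    intro a
    rw [SS_rec q m (a+1) (by omega), Finset.sum_range_succ']
    cases m with
    | zero =>
      rw [Finset.sum_eq_zero]
      · simp [SS_zero, qb_zero]
      · intro b _
        simp [SS, PS_empty' 0 (b+1) (by omega)]
    | succ r =>
      have h0 : SS q (r+1) 0 = 0 := by simp [SS, PS_empty]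
      have ht : ∀ c, q ^ ((c+1) ^ 2) * qBinom q (a+1) (c+1) * SS q (r+1) (c+1)
          = q ^ (r+1) * (q ^ (c * (c + 1)) * qBinom q (a+1) (c+1) * qBinom q r c) := by
        intro c
        rcases lt_or_ge r c with h | h
        · rw [qb_lt q r c h]
          simp [SS, PS_empty' (r+1) (c+1) (by omega)]
        · obtain ⟨e, rfl⟩ : ∃ e, r = e + c := ⟨r - c, by omega⟩
          have := ih e (by omega) c
          rw [add_assoc, this, qb_symm]
          ring
      simp only [ht, h0, mul_zero, add_zero]
      rw [← Finset.mul_sum]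
      have hv := qb_vander q r (a+1) 1
      rw [show r + 1 + a = r + (a + 1) by ring, ← hv]
      congr 1
      rw [Finset.sum_subset (Finset.range_mono (show r + 1 ≤ r + a + 1 by omega)),
        Finset.sum_subset (Finset.range_mono (show a + 1 ≤ r + a + 1 by omega))]
      · intro c _ hc
        rw [qb_lt q (a+1) (c+1) (by simp at hc; omega)]; simp
      · intro c _ hc
        rw [qb_lt q r c (by simpa using hc)]; simp

/-- `∑_{λ ⊢ n−d, λ₁ = n−k} σ(λ) = ∏_{j=1}^{k−d}(q^{n−d} − q^j)`, where
`σ(λ) = q^{∑_{i≥2} λ_i²} γ_q(k−d) ∏_{i≥1}[λ_i choose λ_{i+1}]_q` (and `σ(∅) = 1` when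
`d = n = k`; for the formula to hold one needs `W` proper or `d = n`). -/
theorem sum_sigma_eq (q n k d : ℕ) (hd : d ≤ k) (hk : k ≤ n) (h : k < n ∨ d = n) :
    (∑ᶠ (f : ℕ → ℕ) (_ : IsPartition (n - d) f ∧ f 0 = n - k),
        q ^ (∑ i ∈ Finset.range (n - d), (f (i + 1)) ^ 2) * gammaq q (k - d) *
          ∏ i ∈ Finset.range (n - d), qBinom q (f i) (f (i + 1))) =
      ∏ j ∈ Finset.Icc 1 (k - d), (q ^ (n - d) - q ^ j) := by
  have hL : (∑ᶠ (f : ℕ → ℕ) (_ : IsPartition (n - d) f ∧ f 0 = n - k),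
        q ^ (∑ i ∈ Finset.range (n - d), (f (i + 1)) ^ 2) * gammaq q (k - d) *
          ∏ i ∈ Finset.range (n - d), qBinom q (f i) (f (i + 1)))
      = gammaq q (k - d) * SS q (n - d) (n - k) := by
    unfold SS
    rw [mul_finsum_mem]
    apply finsum_mem_congr (s := PS (n - d) (n - k)) rfl
    intro f _
    unfold wt
    ring
  rw [hL]
  rcases h with h | h
  · obtain ⟨m, rfl⟩ : ∃ m, k = d + m := ⟨k - d, by omega⟩
    obtain ⟨a, rfl⟩ : ∃ a, n = d + m + (a + 1) := ⟨n - (d + m) - 1, by omega⟩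
    rw [show d + m + (a + 1) - d = m + (a + 1) by omega,
      show d + m + (a + 1) - (d + m) = a + 1 by omega, show d + m - d = m by omega, SS_eq,
      gamma_prod q (m + a) m (by omega)]
    rfl
  · obtain rfl : k = n := by omega
    subst h
    simp [SS_zero, gammaq]
end
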